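/- Define X_0 = 1 and X_n = 1 + T_n X_{n-1} in the Hecke algebra, and S^{(n)} = X_1 X_2 ⋯ X_n. Then S^{(n)} = Σ_{u ∈ S_{n+1}} T(u), the sum over all permutations of {1,...,n+1} of the corresponding reduced-word products of generators, and (T_j - t) S^{(n)} = 0 for all 1 ≤ j ≤ n. -/

import Mathlib

noncomputable section

variable {K A : Type} [Field K] [Ring A] [Algebra K A]

/-- X_0 = 1, X_n = 1 + T_n X_{n-1} -/
def heckeX (T : ℕ → A) : ℕ → A
  | 0 => 1
  | k + 1 => 1 + T (k + 1) * heckeX T k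

/-- S^{(n)} = X_1 X_2 ⋯ X_n -/
def heckeS (T : ℕ → A) : ℕ → A
  | 0 => 1
  | k + 1 => heckeS T k * heckeX T (k + 1)

/-- length (number of inversions) of a permutation -/
def permLen {n : ℕ} (u : Equiv.Perm (Fin n)) : ℕ :=
  (Finset.univ.filter fun p : Fin n × Fin n => p.1 < p.2 ∧ u p.2 < u p.1).card

open Equiv Finset

/-- The length of `u` does not increase when `u` is multiplied on the right by a simple
transposition at a descent. -/
theorem permLen_mul_swap_le {n : ℕ} (u : Perm (Fin (n + 1))) (i : Fin n)
    (h : u i.succ < u i.castSucc) :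
    permLen (u * swap i.castSucc i.succ) ≤ permLen u := by
  refine card_le_card_of_injOn
    (fun p ↦ (swap i.castSucc i.succ p.1, swap i.castSucc i.succ p.2)) ?_ ?_
  · rintro ⟨a, b⟩ hab
    rw [mem_coe, mem_filter_univ] at hab ⊢
    rw [Perm.mul_apply, Perm.mul_apply] at hab
    obtain ⟨hlt, hinv⟩ := hab
    refine ⟨?_, hinv⟩
    have hne : ¬(a = i.castSucc ∧ b = i.succ) := by
      rintro ⟨rfl, rfl⟩
      rw [swap_apply_left, swap_apply_right] at hinv
      exact lt_asymm h hinv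
    simp only [swap_apply_def, Fin.ext_iff, Fin.lt_def, apply_ite Fin.val, Fin.val_castSucc,
      Fin.val_succ] at hlt hne ⊢
    split_ifs <;> omega
  · rintro ⟨a, b⟩ - ⟨c, d⟩ - hcd
    simpa using hcd

/-- The permutation whose one-line notation is that of `w` with the largest value inserted at
position `p`. -/
def insertMax {n : ℕ} (p : Fin (n + 1)) (w : Perm (Fin n)) : Perm (Fin (n + 1)) :=
  (finSuccEquiv' p).trans ((optionCongr w).trans (finSuccEquiv' (Fin.last n)).symm)

@[simp]
theorem insertMax_apply_self {n : ℕ} (p : Fin (n + 1)) (w : Perm (Fin n)) :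
    insertMax p w p = Fin.last n := by
  simp [insertMax]

@[simp]
theorem insertMax_apply_succAbove {n : ℕ} (p : Fin (n + 1)) (w : Perm (Fin n)) (i : Fin n) :
    insertMax p w (p.succAbove i) = (w i).castSucc := by
  simp [insertMax]

theorem insertMax_injective (n : ℕ) :
    Function.Injective fun x : Fin (n + 1) × Perm (Fin n) ↦ insertMax x.1 x.2 := by
  rintro ⟨p, w⟩ ⟨q, v⟩ h
  dsimp only at h
  obtain rfl : p = q := by
    apply (insertMax q v).injective
    rw [← h, insertMax_apply_self, h, insertMax_apply_self]
  congr 1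
  ext i : 1
  simpa using DFunLike.congr_fun h (p.succAbove i)

/-- Every permutation arises uniquely by inserting the largest value into a smaller one. -/
def insertMaxEquiv (n : ℕ) : Fin (n + 1) × Perm (Fin n) ≃ Perm (Fin (n + 1)) :=
  .ofBijective _ <| (Fintype.bijective_iff_injective_and_card _).2
    ⟨insertMax_injective n, by simp [Fintype.card_perm, Nat.factorial_succ]⟩

theorem insertMaxEquiv_apply {n : ℕ} (p : Fin (n + 1)) (w : Perm (Fin n)) :
    insertMaxEquiv n (p, w) = insertMax p w :=
  rfl

theorem insertMax_last_one (n : ℕ) : insertMax (Fin.last n) 1 = 1 := by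
  ext x : 1
  cases x using Fin.lastCases with
  | last => simp
  | cast i => simpa using insertMax_apply_succAbove (Fin.last n) 1 i

theorem insertMax_mul_swap_succAbove {n : ℕ} (p : Fin (n + 1)) (w : Perm (Fin n)) (a b : Fin n) :
    insertMax p w * swap (p.succAbove a) (p.succAbove b) = insertMax p (w * swap a b) := by
  ext x : 1
  cases x using Fin.succAboveCases p with
  | x => simp [swap_apply_of_ne_of_ne, Fin.ne_succAbove]
  | p i => simp [Function.Injective.swap_apply p.succAbove_right_injective]

theorem insertMax_succ_mul_swap {n : ℕ} (i : Fin n) (w : Perm (Fin n)) :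
    insertMax i.succ w * swap i.castSucc i.succ = insertMax i.castSucc w := by
  ext x : 1
  cases x using Fin.succAboveCases i.castSucc with
  | x => simp
  | p k =>
    rw [insertMax_apply_succAbove, Perm.mul_apply, ← insertMax_apply_succAbove i.succ w k]
    congr 1
    rcases lt_trichotomy k i with h | rfl | h
    · rw [Fin.succAbove_of_castSucc_lt _ _ (by simpa using h),
        Fin.succAbove_of_castSucc_lt _ _ (Fin.castSucc_lt_succ_iff.2 h.le),
        swap_apply_of_ne_of_ne] <;>
        simp only [ne_eq, Fin.ext_iff, Fin.lt_def, Fin.val_castSucc, Fin.val_succ] at * <;> omega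
    · simp
    · rw [Fin.succAbove_of_le_castSucc _ _ (by simpa using h.le),
        Fin.succAbove_of_le_castSucc _ _ (Fin.succ_le_castSucc_iff.2 h),
        swap_apply_of_ne_of_ne] <;>
        simp only [ne_eq, Fin.ext_iff, Fin.lt_def, Fin.val_castSucc, Fin.val_succ] at * <;> omega

/-- The descending product `T n * T (n - 1) * ⋯ * T (p + 1)`. -/
def descProd (T : ℕ → A) (p : ℕ) : ℕ → A
  | 0 => 1
  | n + 1 => if p ≤ n then T (n + 1) * descProd T p n else 1

theorem descProd_of_le (T : ℕ → A) {p n : ℕ} (h : n ≤ p) : descProd T p n = 1 := by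
  cases n with
  | zero => rfl
  | succ n => rw [descProd, if_neg (by omega)]

theorem descProd_succ (T : ℕ → A) {p n : ℕ} (h : p ≤ n) :
    descProd T p (n + 1) = T (n + 1) * descProd T p n := by
  rw [descProd, if_pos h]

theorem descProd_succ_mul (T : ℕ → A) {p n : ℕ} (h : p < n) :
    descProd T (p + 1) n * T (p + 1) = descProd T p n := by
  induction n with
  | zero => omega
  | succ n ih =>
    rw [descProd_succ T (by omega : p ≤ n)]
    rcases (by omega : p = n ∨ p < n) with rfl | hp
    · rw [descProd_of_le T le_rfl, descProd_of_le T le_rfl, one_mul, mul_one]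
    · rw [descProd_succ T hp, mul_assoc, ih hp]

theorem commute_descProd (T : ℕ → A) {p n : ℕ} {a : A}
    (h : ∀ m, p < m → m ≤ n → Commute a (T m)) : Commute a (descProd T p n) := by
  induction n with
  | zero => exact Commute.one_right a
  | succ n ih =>
    rcases le_or_gt p n with hp | hp
    · rw [descProd_succ T hp]
      exact (h _ (by omega) le_rfl).mul_right (ih fun m h₁ h₂ ↦ h m h₁ (by omega))
    · rw [descProd_of_le T hp]
      exact Commute.one_right a

theorem heckeX_eq_sum (T : ℕ → A) (n : ℕ) :
    heckeX T n = ∑ p : Fin (n + 1), descProd T p n := by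
  induction n with
  | zero => simp [heckeX, descProd]
  | succ n ih =>
    rw [heckeX, ih, Fin.sum_univ_castSucc (n := n + 1), mul_sum, add_comm]
    congr 1
    · exact sum_congr rfl fun p _ ↦ (descProd_succ T (by simpa using p.is_le)).symm
    · exact (descProd_of_le T (by simp)).symm

/-- The product of generators along a reduced word of a permutation, computed by removing the
largest value. -/
def heckeT (T : ℕ → A) : (n : ℕ) → Perm (Fin (n + 1)) → A
  | 0, _ => 1
  | n + 1, u =>
    heckeT T n ((insertMaxEquiv (n + 1)).symm u).2 *
      descProd T ((insertMaxEquiv (n + 1)).symm u).1 (n + 1)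

theorem heckeT_insertMax (T : ℕ → A) {n : ℕ} (p : Fin (n + 2)) (w : Perm (Fin (n + 1))) :
    heckeT T (n + 1) (insertMax p w) = heckeT T n w * descProd T p (n + 1) := by
  rw [heckeT, ← insertMaxEquiv_apply, symm_apply_apply]

theorem heckeT_one (T : ℕ → A) (n : ℕ) : heckeT T n 1 = 1 := by
  induction n with
  | zero => rfl
  | succ n ih =>
    rw [← insertMax_last_one, heckeT_insertMax, ih, one_mul, descProd_of_le T (by simp)]

theorem heckeS_eq_sum (T : ℕ → A) (n : ℕ) :
    heckeS T n = ∑ u : Perm (Fin (n + 1)), heckeT T n u := by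
  induction n with
  | zero => simp [heckeS, heckeT]
  | succ n ih =>
    rw [heckeS, ih, heckeX_eq_sum, ← (insertMaxEquiv (n + 1)).sum_comp, Fintype.sum_prod_type_right,
      sum_mul_sum]
    simp only [insertMaxEquiv_apply, heckeT_insertMax]

section Relations

variable {T : ℕ → A} {N : ℕ}

theorem descProd_mul_of_lt
    (braid : ∀ i, 1 ≤ i → i < N → T i * T (i + 1) * T i = T (i + 1) * T i * T (i + 1))
    (comm : ∀ i j, 1 ≤ i → j ≤ N → i + 2 ≤ j → T i * T j = T j * T i)
    {p n j : ℕ} (hn : n ≤ N) (hp : p < j) (hj : j < n) :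
    descProd T p n * T (j + 1) = T j * descProd T p n := by
  induction n with
  | zero => omega
  | succ n ih =>
    rw [descProd_succ T (by omega)]
    rcases (by omega : j < n ∨ j = n) with h | rfl
    · rw [mul_assoc, ih (by omega) h, ← mul_assoc, ← mul_assoc,
        comm j (n + 1) (by omega) hn (by omega)]
    · obtain ⟨k, rfl⟩ : ∃ k, j = k + 1 := ⟨j - 1, by omega⟩
      have hc : Commute (T (k + 1 + 1)) (descProd T p k) :=
        commute_descProd T fun m h₁ h₂ ↦ (comm m (k + 1 + 1) (by omega) hn (by omega)).symm
      rw [descProd_succ T (by omega), mul_assoc, mul_assoc, ← hc.eq]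
      simp only [← mul_assoc]
      rw [braid (k + 1) (by omega) (by omega)]

theorem heckeT_mul_swap
    (braid : ∀ i, 1 ≤ i → i < N → T i * T (i + 1) * T i = T (i + 1) * T i * T (i + 1))
    (comm : ∀ i j, 1 ≤ i → j ≤ N → i + 2 ≤ j → T i * T j = T j * T i)
    {n : ℕ} (hn : n ≤ N) (u : Perm (Fin (n + 1))) (i : Fin n) (h : u i.castSucc < u i.succ) :
    heckeT T n (u * swap i.castSucc i.succ) = heckeT T n u * T (i + 1) := by
  induction n with
  | zero => exact i.elim0
  | succ n ih =>
    obtain ⟨⟨p, w⟩, rfl⟩ := (insertMaxEquiv (n + 1)).surjective u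
    rw [insertMaxEquiv_apply] at *
    have hi := i.is_lt
    rcases lt_trichotomy p i.castSucc with hp | rfl | hp
    · simp only [Fin.lt_def, Fin.val_castSucc] at hp
      obtain ⟨j, hj⟩ : ∃ j : Fin n, (j : ℕ) + 1 = i := ⟨⟨i - 1, by omega⟩, by simp; omega⟩
      have h₁ : i.castSucc = p.succAbove j.castSucc := by
        rw [Fin.succAbove_of_le_castSucc _ _ (by simp [Fin.le_def]; omega)]
        simp [Fin.ext_iff]; omega
      have h₂ : i.succ = p.succAbove j.succ := by
        rw [Fin.succAbove_of_le_castSucc _ _ (by simp [Fin.le_def]; omega)]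
        simp [Fin.ext_iff]; omega
      rw [h₁, h₂, insertMax_apply_succAbove, insertMax_apply_succAbove,
        Fin.castSucc_lt_castSucc_iff] at h
      rw [h₁, h₂, insertMax_mul_swap_succAbove, heckeT_insertMax, heckeT_insertMax,
        ih (by omega) w j h, mul_assoc, mul_assoc, hj,
        descProd_mul_of_lt braid comm hn hp hi]
    · rw [insertMax_apply_self] at h
      exact absurd h (Fin.le_last _).not_gt
    · rcases (by simp only [Fin.lt_def, Fin.ext_iff, Fin.val_succ, Fin.val_castSucc] at *; omega :
        p = i.succ ∨ i.succ < p) with rfl | hp'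
      · rw [insertMax_succ_mul_swap, heckeT_insertMax, heckeT_insertMax, mul_assoc,
          Fin.val_succ, Fin.val_castSucc, descProd_succ_mul T hi]
      · simp only [Fin.lt_def, Fin.val_succ] at hp'
        have hp_lt := p.is_lt
        obtain ⟨j, hj⟩ : ∃ j : Fin n, (j : ℕ) = i := ⟨⟨i, by omega⟩, rfl⟩
        have h₁ : i.castSucc = p.succAbove j.castSucc := by
          rw [Fin.succAbove_of_castSucc_lt _ _ (by simp [Fin.lt_def]; omega)]
          simp [Fin.ext_iff]; omega
        have h₂ : i.succ = p.succAbove j.succ := by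
          rw [Fin.succAbove_of_castSucc_lt _ _ (by simp [Fin.lt_def]; omega)]
          simp [Fin.ext_iff]; omega
        rw [h₁, h₂, insertMax_apply_succAbove, insertMax_apply_succAbove,
          Fin.castSucc_lt_castSucc_iff] at h
        have hc : Commute (T (i + 1)) (descProd T p (n + 1)) :=
          commute_descProd T fun m hm₁ hm₂ ↦ comm _ m (by omega) (by omega) (by omega)
        rw [h₁, h₂, insertMax_mul_swap_succAbove, heckeT_insertMax, heckeT_insertMax,
          ih (by omega) w j h, mul_assoc, mul_assoc, hj, hc.eq]

theorem commute_heckeX (comm : ∀ i j, 1 ≤ i → j ≤ N → i + 2 ≤ j → T i * T j = T j * T i)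
    {k j : ℕ} (hj : j ≤ N) (hk : k + 2 ≤ j) : Commute (T j) (heckeX T k) := by
  rw [heckeX_eq_sum]
  exact Commute.sum_right _ _ _ fun p _ ↦ commute_descProd T fun m h₁ h₂ ↦
    (comm m j (by omega) hj (by omega)).symm

theorem commute_heckeS (comm : ∀ i j, 1 ≤ i → j ≤ N → i + 2 ≤ j → T i * T j = T j * T i)
    {k j : ℕ} (hj : j ≤ N) (hk : k + 2 ≤ j) : Commute (T j) (heckeS T k) := by
  induction k with
  | zero => exact Commute.one_right _
  | succ k ih => exact (ih (by omega)).mul_right (commute_heckeX comm hj hk)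

theorem sub_mul_heckeX_mul_heckeX_succ {t : K}
    (braid : ∀ i, 1 ≤ i → i < N → T i * T (i + 1) * T i = T (i + 1) * T i * T (i + 1))
    (comm : ∀ i j, 1 ≤ i → j ≤ N → i + 2 ≤ j → T i * T j = T j * T i)
    (quad : ∀ i, 1 ≤ i → i ≤ N → (T i - algebraMap K A t) * (T i + 1) = 0)
    {k : ℕ} (hk : k < N) :
    (T (k + 1) - algebraMap K A t) * (heckeX T k * heckeX T (k + 1)) = 0 := by
  induction k with
  | zero => simpa [heckeX, add_comm] using quad 1 le_rfl hk
  | succ k ih =>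
    have hX : heckeX T (k + 1) * heckeX T (k + 1 + 1) =
        (T (k + 1 + 1) + 1) * heckeX T (k + 1) +
          T (k + 1) * T (k + 1 + 1) * (heckeX T k * heckeX T (k + 1)) := by
      have hc := (commute_heckeX comm hk (le_refl (k + 2))).eq
      calc heckeX T (k + 1) * heckeX T (k + 1 + 1)
          = heckeX T (k + 1) + (1 + T (k + 1) * heckeX T k) * (T (k + 1 + 1) * heckeX T (k + 1)) := by
            rw [heckeX.eq_2 T (k + 1), mul_add, mul_one, ← heckeX.eq_2]
        _ = (T (k + 1 + 1) + 1) * heckeX T (k + 1) +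
              T (k + 1) * (heckeX T k * T (k + 1 + 1)) * heckeX T (k + 1) := by noncomm_ring
        _ = _ := by rw [← hc]; simp only [mul_assoc]
    have hT : (T (k + 1 + 1) - algebraMap K A t) * (T (k + 1) * T (k + 1 + 1)) =
        T (k + 1) * T (k + 1 + 1) * (T (k + 1) - algebraMap K A t) := by
      rw [sub_mul, mul_sub, Algebra.commutes, ← mul_assoc, braid (k + 1) (by omega) hk]
    rw [hX, mul_add, ← mul_assoc, quad _ (by omega) hk, zero_mul, zero_add, ← mul_assoc, hT,
      mul_assoc, ih (by omega), mul_zero]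

theorem sub_mul_heckeS {t : K}
    (braid : ∀ i, 1 ≤ i → i < N → T i * T (i + 1) * T i = T (i + 1) * T i * T (i + 1))
    (comm : ∀ i j, 1 ≤ i → j ≤ N → i + 2 ≤ j → T i * T j = T j * T i)
    (quad : ∀ i, 1 ≤ i → i ≤ N → (T i - algebraMap K A t) * (T i + 1) = 0)
    {n j : ℕ} (hn : n ≤ N) (hj : 1 ≤ j) (hjn : j ≤ n) :
    (T j - algebraMap K A t) * heckeS T n = 0 := by
  induction n with
  | zero => omega
  | succ n ih =>
    rcases (by omega : j ≤ n ∨ j = n + 1) with h | rfl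
    · rw [heckeS, ← mul_assoc, ih (by omega) h, zero_mul]
    · have hX := sub_mul_heckeX_mul_heckeX_succ braid comm quad hn
      cases n with
      | zero => simpa [heckeS, heckeX] using hX
      | succ n =>
        have hc : Commute (T (n + 1 + 1) - algebraMap K A t) (heckeS T n) :=
          (commute_heckeS comm hn le_rfl).sub_left (Algebra.commutes _ _)
        rw [heckeS, heckeS, mul_assoc, ← mul_assoc, hc.eq, mul_assoc, hX, mul_zero]

end Relations

/-- S^{(n)} = Σ_{u ∈ S_{n+1}} T(u) (the function u ↦ T(u) being
determined by T(1)=1 and T(u s_i) = T(u) T_i whenever the length increases),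
and (T_j - t) S^{(n)} = 0 for 1 ≤ j ≤ n. -/
theorem heckeS_sum_and_symmetric (K A : Type) [Field K] [Ring A] [Algebra K A]
    (t : K) (n : ℕ) (T : ℕ → A)
    (braid : ∀ i, 1 ≤ i → i < n → T i * T (i + 1) * T i = T (i + 1) * T i * T (i + 1))
    (comm : ∀ i j, 1 ≤ i → j ≤ n → i + 2 ≤ j → T i * T j = T j * T i)
    (quad : ∀ i, 1 ≤ i → i ≤ n → (T i - algebraMap K A t) * (T i + 1) = 0) :
    (∃ Tw : Equiv.Perm (Fin (n + 1)) → A,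
      Tw 1 = 1 ∧
      (∀ (u : Equiv.Perm (Fin (n + 1))) (i : Fin n),
        permLen (u * Equiv.swap i.castSucc i.succ) = permLen u + 1 →
        Tw (u * Equiv.swap i.castSucc i.succ) = Tw u * T (i.1 + 1)) ∧
      heckeS T n = ∑ u : Equiv.Perm (Fin (n + 1)), Tw u) ∧
    (∀ j, 1 ≤ j → j ≤ n → (T j - algebraMap K A t) * heckeS T n = 0) := by
  refine ⟨⟨heckeT T n, heckeT_one T n, fun u i h ↦ ?_, heckeS_eq_sum T n⟩,
    fun j hj hjn ↦ sub_mul_heckeS braid comm quad le_rfl hj hjn⟩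
  refine heckeT_mul_swap braid comm le_rfl u i (lt_of_not_ge fun hge ↦ ?_)
  have hlt := lt_of_le_of_ne hge (u.injective.ne Fin.castSucc_lt_succ.ne')
  have := permLen_mul_swap_le u i hlt
  omega
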